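/- Let χ be a linear functional on W of height -1, 0 or 1 and let λ, λ' ∈ Λ(χ) with (λ, λ') ∉ Θ(χ) and λ + λ' ≠ p-1. Then Ext(K_{λ'}, V_χ(λ)), taken in the category of W_0-modules with p-character χ (with V_χ(λ) regarded as a W_0-module by restriction), is isomorphic to K if one of the following holds: (i) [λ-λ'] = 1 and λ ∈ {1, p-1}; (ii) [λ-λ'] ∈ {2, 3}; (iii) [λ-λ'] = 4 and p > 5; (iv) [λ-λ'] = 4 and λ ∈ {0, 3}; (v) [λ-λ'] = 5 and λ ∈ {0, 4}; (vi) [λ-λ'] = 6, p > 7, and 2λ = 5 + s or 2λ = 5 - s for some s ∈ K with s^2 = 19; and Ext(K_{λ'}, V_χ(λ)) = 0 otherwise. -/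

import Mathlib

/-!
Common setup: the Witt algebra `W` over `K` (char `p > 3`) has basis
`e_{-1}, e_0, ..., e_{p-2}` with `[e_i, e_j] = (j-i) e_{i+j}` (and `e_k = 0`
outside the range), and `p`-mapping `e_i^{[p]} = δ_{i0} e_i`.  A module with
`p`-character `χ` over `W` (resp. the subalgebra `W_0 = <e_0, ..., e_{p-2}>`)
is given by a family of endomorphisms `ρ k` (`k : ℤ`, vanishing outside
`[lo, p-2]` where `lo = -1` for `W` and `lo = 0` for `W_0`) satisfying the
bracket relations and `(ρ i)^p - δ_{i0} ρ i = χ(e_i)^p • 1`.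

The Baer Ext space `Ext(N, M)` of two such modules, in the category of
modules with `p`-character `χ`, is realized concretely: an extension
`0 → M → E → N → 0` admits a linear splitting `E ≃ M ⊕ N`, under which the
action of `e_k` is `(m, n) ↦ (ρM k m + c k n, ρN k n)` for a "cocycle"
`c : ℤ → (N →ₗ M)`; the conditions for `E` to be a module with `p`-character
`χ` are the cocycle conditions below, Baer equivalence corresponds to
differing by a coboundary, and the Baer sum / scalar action correspond to the
linear structure on cocycles.  So `Ext(N, M) ≅ cocycles / coboundaries`.
-/

set_option maxHeartbeats 1000000
set_option synthInstance.maxHeartbeats 1000000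

noncomputable section

/-- The coefficient `(-1)^j · (i!/(i-j)!) · ((j+1)λ - i + j)` of the action
`e_j · v_i = (coefficient) · v_{i-j}` on the reduced Verma module; it vanishes
for `j > i` since then `Nat.descFactorial i j = 0`. -/
def wCoef (K : Type) [Field K] (lam : K) (j i : ℕ) : K :=
  (-1 : K) ^ j * (Nat.descFactorial i j : K) * (((j : K) + 1) * lam - (i : K) + (j : K))

/-- Matrices (in the basis `v_0, ..., v_{p-1}`) of the generators `e_j`
(`j : ℤ`) acting on the reduced Verma module `V_χ(λ)`; here `c = χ(e_{-1})^p`.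
`e_{-1} v_i = v_{i+1}` for `i < p-1`, `e_{-1} v_{p-1} = c v_0`, and for
`0 ≤ j ≤ p-2`, `e_j v_i = (-1)^j (i!/(i-j)!) ((j+1)λ - i + j) v_{i-j}`. -/
def vermaMat (K : Type) [Field K] (p : ℕ) (c lam : K) : ℤ → Matrix (Fin p) (Fin p) K :=
  fun j =>
    if j = -1 then
      Matrix.of fun k l =>
        if (k : ℕ) = (l : ℕ) + 1 then 1
        else if (k : ℕ) = 0 ∧ (l : ℕ) = p - 1 then c else 0
    else if 0 ≤ j ∧ j ≤ (p : ℤ) - 2 then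
      Matrix.of fun k l =>
        if (l : ℕ) = (k : ℕ) + j.toNat then wCoef K lam j.toNat (l : ℕ) else 0
    else 0

/-- The action of the basis elements `e_j` (`j : ℤ`) on the reduced Verma
module `V_χ(λ)`, with `c = χ(e_{-1})^p`. -/
def vermaRho (K : Type) [Field K] (p : ℕ) (c lam : K) : ℤ → Module.End K (Fin p → K) :=
  fun j => Matrix.toLin' (vermaMat K p c lam j)

/-- The one-dimensional `W_0`-module `K_λ`: `e_0` acts by `λ`, all other `e_j` act by `0`. -/
def oneDimRho (K : Type) [Field K] (lam : K) : ℤ → Module.End K K :=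
  fun j => if j = 0 then lam • (1 : Module.End K K) else 0

/-- The one-dimensional trivial module: every basis element acts by `0`. -/
def trivRho (K : Type) [Field K] : ℤ → Module.End K K := fun _ => 0

/-- The coefficient `(-1)^(j+1) · ((i+1)!/(i-j)!)` of the action
`e_j · u_i = (coefficient) · u_{i-j}` on the `(p-1)`-dimensional simple module `S`. -/
def sCoef (K : Type) [Field K] (j i : ℕ) : K :=
  (-1 : K) ^ (j + 1) * (Nat.descFactorial (i + 1) (j + 1) : K)

/-- Matrices (in the basis `u_0, ..., u_{p-2}`) of the generators `e_j` acting on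
the `(p-1)`-dimensional simple restricted module `S = V_0(p-1)/Soc(V_0(p-1))`. -/
def sMat (K : Type) [Field K] (p : ℕ) : ℤ → Matrix (Fin (p - 1)) (Fin (p - 1)) K :=
  fun j =>
    if j = -1 then
      Matrix.of fun k l => if (k : ℕ) = (l : ℕ) + 1 then 1 else 0
    else if 0 ≤ j ∧ j ≤ (p : ℤ) - 2 then
      Matrix.of fun k l =>
        if (l : ℕ) = (k : ℕ) + j.toNat then sCoef K j.toNat (l : ℕ) else 0
    else 0

/-- The action of the basis elements `e_j` on the simple module `S`. -/
def sRho (K : Type) [Field K] (p : ℕ) : ℤ → Module.End K (Fin (p - 1) → K) :=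
  fun j => Matrix.toLin' (sMat K p j)

section ExtSpace

variable (K : Type) [Field K] (M N : Type) [AddCommGroup M] [Module K M]
  [AddCommGroup N] [Module K N]

/-- Constraint: a cocycle vanishes outside the index range `[lo, p-2]`. -/
def suppConstraint (p : ℕ) (lo k : ℤ) : (ℤ → N →ₗ[K] M) →ₗ[K] (N →ₗ[K] M) :=
  if k < lo ∨ (p : ℤ) - 2 < k then LinearMap.proj k else 0

variable {M N}

/-- Constraint on a cocycle coming from the bracket relation
`[e_i, e_j] = (j - i) e_{i+j}`:
`(j-i) c(i+j) = ρM i ∘ c j + c i ∘ ρN j - ρM j ∘ c i - c j ∘ ρN i`. -/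
def bracketConstraint (p : ℕ) (lo : ℤ) (ρM : ℤ → Module.End K M)
    (ρN : ℤ → Module.End K N) (i j : ℤ) :
    (ℤ → N →ₗ[K] M) →ₗ[K] (N →ₗ[K] M) :=
  if lo ≤ i ∧ i ≤ (p : ℤ) - 2 ∧ lo ≤ j ∧ j ≤ (p : ℤ) - 2 then
    ((j - i : ℤ) : K) • LinearMap.proj (i + j)
      - LinearMap.llcomp K N M M (ρM i) ∘ₗ LinearMap.proj j
      - LinearMap.lcomp K M (ρN j) ∘ₗ LinearMap.proj i
      + LinearMap.llcomp K N M M (ρM j) ∘ₗ LinearMap.proj i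
      + LinearMap.lcomp K M (ρN i) ∘ₗ LinearMap.proj j
  else 0

/-- Constraint on a cocycle expressing that the extension has `p`-character `χ`:
on the extension `E = M ⊕ N` the `(N → M)`-component of `(e_i)^p` is
`∑_{k<p} (ρM i)^k ∘ c i ∘ (ρN i)^(p-1-k)`, and this must agree with the
`(N → M)`-component of `e_i^{[p]} + χ(e_i)^p • 1`, which is `δ_{i0} c i`
(the scalar `χ(e_i)^p` contributes nothing off the diagonal, and the diagonal
blocks hold since `M`, `N` have `p`-character `χ`). -/
def pcharConstraint (p : ℕ) (lo : ℤ) (ρM : ℤ → Module.End K M)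
    (ρN : ℤ → Module.End K N) (i : ℤ) :
    (ℤ → N →ₗ[K] M) →ₗ[K] (N →ₗ[K] M) :=
  if lo ≤ i ∧ i ≤ (p : ℤ) - 2 then
    (∑ k ∈ Finset.range p,
        LinearMap.llcomp K N M M ((ρM i) ^ k) ∘ₗ
          LinearMap.lcomp K M ((ρN i) ^ (p - 1 - k)) ∘ₗ LinearMap.proj i)
      - (if i = 0 then (LinearMap.proj 0 : (ℤ → N →ₗ[K] M) →ₗ[K] (N →ₗ[K] M)) else 0)
  else 0

/-- The space of cocycles: families `c : ℤ → (N →ₗ M)` (the values of a linear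
map `W → Hom(N, M)` on the basis, `lo = -1` for `W` and `lo = 0` for `W_0`)
such that `M ⊕ N` with action `e_k (m, n) = (ρM k m + c k n, ρN k n)` is a
module with `p`-character `χ`. -/
def cocycles (p : ℕ) (lo : ℤ) (ρM : ℤ → Module.End K M) (ρN : ℤ → Module.End K N) :
    Submodule K (ℤ → N →ₗ[K] M) :=
  (⨅ k : ℤ, LinearMap.ker (suppConstraint K M N p lo k)) ⊓
    (⨅ i : ℤ, ⨅ j : ℤ, LinearMap.ker (bracketConstraint K p lo ρM ρN i j)) ⊓
    (⨅ i : ℤ, LinearMap.ker (pcharConstraint K p lo ρM ρN i))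

/-- The coboundaries: cocycles of the form `k ↦ ρM k ∘ f - f ∘ ρN k` for a
linear map `f : N → M`; these are exactly the cocycles of split extensions,
and two cocycles give Baer-equivalent extensions iff they differ by a
coboundary. -/
def coboundaries (p : ℕ) (lo : ℤ) (ρM : ℤ → Module.End K M) (ρN : ℤ → Module.End K N) :
    Submodule K (ℤ → N →ₗ[K] M) :=
  LinearMap.range (LinearMap.pi fun k : ℤ =>
    if lo ≤ k ∧ k ≤ (p : ℤ) - 2 then
      LinearMap.llcomp K N M M (ρM k) - LinearMap.lcomp K M (ρN k)
    else 0)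

/-- The Baer Ext space `Ext(N, M)` in the category of modules with
`p`-character `χ` (over `W` if `lo = -1`, over `W_0` if `lo = 0`), realized
as cocycles modulo coboundaries. -/
abbrev extSpace (p : ℕ) (lo : ℤ) (ρM : ℤ → Module.End K M) (ρN : ℤ → Module.End K N) :=
  (cocycles K p lo ρM ρN) ⧸
    (Submodule.comap (cocycles K p lo ρM ρN).subtype (coboundaries K p lo ρM ρN))

end ExtSpace

end

section

variable {K : Type} [Field K]

/-- Extension by zero of a vector indexed by `Fin p` to a function on `ℕ`. -/
def extendZero {p : ℕ} (v : Fin p → K) (n : ℕ) : K :=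
  if h : n < p then v ⟨n, h⟩ else 0

theorem extendZero_of_le {p : ℕ} (v : Fin p → K) {n : ℕ} (h : p ≤ n) : extendZero v n = 0 :=
  dif_neg (not_lt.mpr h)

theorem extendZero_val {p : ℕ} (v : Fin p → K) (k : Fin p) : extendZero v k = v k := by
  simp [extendZero]

theorem extendZero_ext {p : ℕ} {v w : Fin p → K} (h : ∀ n, extendZero v n = extendZero w n) :
    v = w := by
  funext k
  rw [← extendZero_val v k, ← extendZero_val w k, h]

@[simp]
theorem extendZero_add {p : ℕ} (v w : Fin p → K) (n : ℕ) :
    extendZero (v + w) n = extendZero v n + extendZero w n := by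
  unfold extendZero; split_ifs <;> simp

@[simp]
theorem extendZero_sub {p : ℕ} (v w : Fin p → K) (n : ℕ) :
    extendZero (v - w) n = extendZero v n - extendZero w n := by
  unfold extendZero; split_ifs <;> simp

@[simp]
theorem extendZero_smul {p : ℕ} (a : K) (v : Fin p → K) (n : ℕ) :
    extendZero (a • v) n = a * extendZero v n := by
  unfold extendZero; split_ifs <;> simp

@[simp]
theorem extendZero_zero {p : ℕ} (n : ℕ) : extendZero (0 : Fin p → K) n = 0 := by
  unfold extendZero; split_ifs <;> simp

@[simp]
theorem extendZero_sum {p : ℕ} {ι : Type} (s : Finset ι) (v : ι → Fin p → K) (n : ℕ) :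
    extendZero (∑ i ∈ s, v i) n = ∑ i ∈ s, extendZero (v i) n := by
  unfold extendZero; split_ifs <;> simp

theorem extendZero_restrict {p : ℕ} {f : ℕ → K} (hf : ∀ n, p ≤ n → f n = 0) (n : ℕ) :
    extendZero (fun k : Fin p => f k) n = f n := by
  unfold extendZero
  split_ifs with h
  · rfl
  · exact (hf n (not_lt.mp h)).symm

theorem wCoef_zero_left (lam : K) (n : ℕ) : wCoef K lam 0 n = lam - n := by
  simp [wCoef]

theorem wCoef_one_left (lam : K) (n : ℕ) : wCoef K lam 1 n = -n * (2 * lam - n + 1) := by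
  simp only [wCoef, pow_one, Nat.descFactorial_one]; push_cast; ring

theorem wCoef_commutator (lam : K) (i j n : ℕ) :
    wCoef K lam i (n + i) * wCoef K lam j (n + i + j)
      - wCoef K lam j (n + j) * wCoef K lam i (n + j + i)
      = ((j : K) - i) * wCoef K lam (i + j) (n + (i + j)) := by
  have key (i j : ℕ) : (n + i).descFactorial i * (n + i + j).descFactorial j
      = (n + (i + j)).descFactorial (i + j) := by
    have h1 := Nat.factorial_mul_descFactorial (Nat.le_add_left i n)
    have h2 := Nat.factorial_mul_descFactorial (Nat.le_add_left j (n + i))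
    have h3 := Nat.factorial_mul_descFactorial (Nat.le_add_left (i + j) n)
    rw [Nat.add_sub_cancel] at h1 h2 h3
    apply Nat.eq_of_mul_eq_mul_left (Nat.factorial_pos n)
    rw [← mul_assoc, h1, h2, h3, add_assoc]
  have k1 := congrArg (Nat.cast (R := K)) (key i j)
  have k2 := congrArg (Nat.cast (R := K)) (key j i)
  rw [add_comm j i] at k2
  push_cast at k1 k2
  have e1 : wCoef K lam i (n + i) * wCoef K lam j (n + i + j) = (-1) ^ (i + j) *
      ((n + (i + j)).descFactorial (i + j) : K) *
      ((((i : K) + 1) * lam - (n + i) + i) * (((j : K) + 1) * lam - (n + i + j) + j)) := by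
    rw [← k1]; simp only [wCoef]; push_cast; ring
  have e2 : wCoef K lam j (n + j) * wCoef K lam i (n + j + i) = (-1) ^ (i + j) *
      ((n + (i + j)).descFactorial (i + j) : K) *
      ((((j : K) + 1) * lam - (n + j) + j) * (((i : K) + 1) * lam - (n + j + i) + i)) := by
    rw [← k2]; simp only [wCoef]; push_cast; ring
  rw [e1, e2]
  simp only [wCoef]
  push_cast
  ring

/-- The action of `e_j` for `j ≥ 0` in coordinates; the formula also covers `j ≥ p - 1`,
where both sides vanish. -/
theorem extendZero_vermaRho {p : ℕ} [CharP K p] (hp : 1 < p) (c lam : K) (j : ℕ)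
    (v : Fin p → K) (n : ℕ) :
    extendZero (vermaRho K p c lam (j : ℤ) v) n
      = wCoef K lam j (n + j) * extendZero v (n + j) := by
  by_cases hn : n < p
  swap
  · rw [extendZero_of_le _ (not_lt.mp hn), extendZero_of_le _ (by omega), mul_zero]
  by_cases hj : (j : ℤ) ≤ (p : ℤ) - 2
  · rw [extendZero, dif_pos hn]
    have h1 : ¬ ((j : ℤ) = -1) := by omega
    simp only [vermaRho, vermaMat, h1, if_false, Int.natCast_nonneg, hj, and_self, if_true,
      Int.toNat_natCast, Matrix.toLin'_apply, Matrix.mulVec, dotProduct, Matrix.of_apply]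
    by_cases hnj : n + j < p
    · rw [Finset.sum_eq_single ⟨n + j, hnj⟩]
      · simp [extendZero, hnj]
      · intro b _ hb
        rw [if_neg, zero_mul]
        intro h
        exact hb (Fin.ext h)
      · simp
    · rw [extendZero_of_le _ (by omega), mul_zero]
      apply Finset.sum_eq_zero
      intro b _
      rw [if_neg, zero_mul]
      have := b.2
      omega
  · have h0 : vermaRho K p c lam (j : ℤ) = 0 := by
      have h1 : ¬ ((j : ℤ) = -1) := by omega
      simp [vermaRho, vermaMat, h1, hj]
    rw [h0]
    simp only [LinearMap.zero_apply, extendZero_zero]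
    by_cases hnj : n + j < p
    · obtain rfl : n = 0 := by omega
      obtain rfl : p = j + 1 := by omega
      have : ((j : K) + 1) = 0 := by exact_mod_cast CharP.cast_eq_zero K (j + 1)
      simp [wCoef, this]
    · rw [extendZero_of_le _ (by omega), mul_zero]

theorem vermaRho_commutator {p : ℕ} [CharP K p] (hp : 1 < p) (c lam : K) (i j : ℕ)
    (v : Fin p → K) :
    vermaRho K p c lam (i : ℤ) (vermaRho K p c lam (j : ℤ) v)
      - vermaRho K p c lam (j : ℤ) (vermaRho K p c lam (i : ℤ) v)
      = ((j : K) - i) • vermaRho K p c lam ((i + j : ℕ) : ℤ) v := by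
  refine extendZero_ext fun n => ?_
  simp only [extendZero_sub, extendZero_smul, extendZero_vermaRho hp]
  have := wCoef_commutator lam i j n
  rw [← mul_assoc, ← mul_assoc, ← mul_assoc, ← this]
  rw [show n + j + i = n + i + j by ring, show n + (i + j) = n + i + j by ring]
  ring

theorem vermaRho_pow_eq_zero {p : ℕ} [CharP K p] (hp : 1 < p) (c lam : K) {i : ℕ} (hi : 2 ≤ i) :
    vermaRho K p c lam (i : ℤ) ^ (p - 1) = 0 := by
  have key (m : ℕ) (v : Fin p → K) (n : ℕ) (h : p ≤ n + i * m) :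
      extendZero ((vermaRho K p c lam (i : ℤ) ^ m) v) n = 0 := by
    induction m generalizing n with
    | zero => exact extendZero_of_le _ (by simpa using h)
    | succ m ih =>
      rw [pow_succ', Module.End.mul_apply, extendZero_vermaRho hp, ih _ (by rw [mul_add] at h; omega),
        mul_zero]
  refine LinearMap.ext fun v => extendZero_ext fun n => ?_
  rw [key _ _ _ ?_]
  · simp
  · have : 2 * (p - 1) ≤ i * (p - 1) := Nat.mul_le_mul_right _ hi
    omega

theorem extendZero_vermaRho_zero {p : ℕ} [CharP K p] (hp : 1 < p) (c lam : K)
    (v : Fin p → K) (n : ℕ) :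
    extendZero (vermaRho K p c lam 0 v) n = (lam - n) * extendZero v n := by
  have h := extendZero_vermaRho hp c lam 0 v n
  rwa [Nat.cast_zero, add_zero, wCoef_zero_left] at h

theorem vermaRho_zero_pow {p : ℕ} [CharP K p] (hp : 1 < p) (c lam : K) (m : ℕ)
    (v : Fin p → K) (n : ℕ) :
    extendZero ((vermaRho K p c lam 0 ^ m) v) n = (lam - n) ^ m * extendZero v n := by
  induction m with
  | zero => simp
  | succ m ih =>
    rw [pow_succ', Module.End.mul_apply, extendZero_vermaRho_zero hp, ih]
    ring

theorem oneDimRho_apply_one (lam' : K) (j : ℤ) :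
    oneDimRho K lam' j 1 = if j = 0 then lam' else 0 := by
  unfold oneDimRho; split_ifs <;> simp

theorem oneDimRho_zero_pow (lam' : K) (m : ℕ) : (oneDimRho K lam' 0 ^ m) 1 = lam' ^ m := by
  simp [oneDimRho, smul_pow]

theorem mem_cocycles_iff {p : ℕ} [CharP K p] (hp : 1 < p) (x lam lam' : K)
    (c : ℤ → K →ₗ[K] (Fin p → K)) :
    c ∈ cocycles K p 0 (vermaRho K p x lam) (oneDimRho K lam') ↔
      (∀ z : ℤ, (z < 0 ∨ (p : ℤ) - 2 < z) → c z = 0) ∧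
      (∀ i j : ℕ, i + 2 ≤ p → j + 2 ≤ p →
        ((j : K) - i) • c ((i + j : ℕ) : ℤ) 1 = vermaRho K p x lam (i : ℤ) (c (j : ℤ) 1)
          + (if j = 0 then lam' else 0) • c (i : ℤ) 1 - vermaRho K p x lam (j : ℤ) (c (i : ℤ) 1)
          - (if i = 0 then lam' else 0) • c (j : ℤ) 1) ∧
      (∀ n : ℕ, (∑ k ∈ Finset.range p, (lam - n) ^ k * lam' ^ (p - 1 - k)) * extendZero (c 0 1) n
        = extendZero (c 0 1) n) ∧
      (∀ i : ℕ, 1 ≤ i → i + 2 ≤ p → (vermaRho K p x lam (i : ℤ) ^ (p - 1)) (c (i : ℤ) 1) = 0) := by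
  have hmap (f : K →ₗ[K] (Fin p → K)) (a : K) : f a = a • f 1 := by
    rw [← map_smul, smul_eq_mul, mul_one]
  simp only [cocycles, Submodule.mem_inf, Submodule.mem_iInf, LinearMap.mem_ker]
  rw [and_assoc]
  refine and_congr ?_ (and_congr ?_ ?_)
  · refine forall_congr' fun z => ?_
    unfold suppConstraint
    split_ifs with h <;> simp [h]
  · have hb (i j : ℕ) (hi : i + 2 ≤ p) (hj : j + 2 ≤ p) :
        bracketConstraint K p 0 (vermaRho K p x lam) (oneDimRho K lam') i j c = 0 ↔
        ((j : K) - i) • c ((i + j : ℕ) : ℤ) 1 = vermaRho K p x lam (i : ℤ) (c (j : ℤ) 1)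
          + (if j = 0 then lam' else 0) • c (i : ℤ) 1 - vermaRho K p x lam (j : ℤ) (c (i : ℤ) 1)
          - (if i = 0 then lam' else 0) • c (j : ℤ) 1 := by
      unfold bracketConstraint
      rw [if_pos (by omega), LinearMap.ext_ring_iff]
      simp only [LinearMap.add_apply, LinearMap.sub_apply, LinearMap.smul_apply,
        LinearMap.comp_apply, LinearMap.proj_apply, LinearMap.llcomp_apply,
        LinearMap.lcomp_apply, oneDimRho_apply_one, LinearMap.zero_apply, Nat.cast_eq_zero]
      rw [hmap (c i) (if j = 0 then lam' else 0), hmap (c j) (if i = 0 then lam' else 0)]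
      push_cast
      rw [← sub_eq_zero (a := ((j : K) - i) • c (i + j : ℤ) 1)]
      apply Eq.congr_left
      abel
    constructor
    · intro h i j hi hj
      exact (hb i j hi hj).1 (h i j)
    · intro h i j
      by_cases hij : 0 ≤ i ∧ i ≤ (p : ℤ) - 2 ∧ 0 ≤ j ∧ j ≤ (p : ℤ) - 2
      · obtain ⟨h1, h2, h3, h4⟩ := hij
        lift i to ℕ using h1
        lift j to ℕ using h3
        exact (hb i j (by omega) (by omega)).2 (h i j (by omega) (by omega))
      · unfold bracketConstraint
        rw [if_neg hij, LinearMap.zero_apply]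
  · have h0 : pcharConstraint K p 0 (vermaRho K p x lam) (oneDimRho K lam') 0 c = 0 ↔
        ∀ n : ℕ, (∑ k ∈ Finset.range p, (lam - n) ^ k * lam' ^ (p - 1 - k)) * extendZero (c 0 1) n
        = extendZero (c 0 1) n := by
      unfold pcharConstraint
      rw [if_pos (by omega), if_pos rfl, LinearMap.ext_ring_iff]
      simp only [LinearMap.sub_apply, LinearMap.sum_apply, LinearMap.comp_apply,
        LinearMap.proj_apply, LinearMap.llcomp_apply, LinearMap.lcomp_apply,
        LinearMap.zero_apply, oneDimRho_zero_pow, sub_eq_zero]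
      have hn (n : ℕ) : extendZero (∑ k ∈ Finset.range p,
          (vermaRho K p x lam 0 ^ k) (c 0 (lam' ^ (p - 1 - k)))) n
          = (∑ k ∈ Finset.range p, (lam - n) ^ k * lam' ^ (p - 1 - k)) * extendZero (c 0 1) n := by
        rw [extendZero_sum, Finset.sum_mul]
        refine Finset.sum_congr rfl fun k _ => ?_
        rw [hmap, map_smul, extendZero_smul, vermaRho_zero_pow hp]
        ring
      constructor
      · intro h n
        rw [← hn, h]
      · intro h
        refine extendZero_ext fun n => ?_
        rw [hn, h]
    have hpos (i : ℕ) (hi : 1 ≤ i) (hip : i + 2 ≤ p) :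
        pcharConstraint K p 0 (vermaRho K p x lam) (oneDimRho K lam') i c = 0 ↔
        (vermaRho K p x lam (i : ℤ) ^ (p - 1)) (c (i : ℤ) 1) = 0 := by
      have hi0 : ¬ ((i : ℤ) = 0) := by omega
      unfold pcharConstraint
      rw [if_pos (by omega), if_neg hi0, LinearMap.ext_ring_iff]
      simp only [LinearMap.sub_apply, LinearMap.sum_apply, LinearMap.comp_apply,
        LinearMap.proj_apply, LinearMap.llcomp_apply, LinearMap.lcomp_apply,
        LinearMap.zero_apply, sub_zero]
      rw [Finset.sum_eq_single (p - 1)]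
      · simp
      · intro k hk hkp
        rw [Finset.mem_range] at hk
        simp [oneDimRho, show i ≠ 0 by omega, zero_pow (show p - 1 - k ≠ 0 by omega)]
      · intro h
        exact absurd (Finset.mem_range.2 (by omega)) h
    constructor
    · intro h
      exact ⟨h0.1 (h 0), fun i hi hip => (hpos i hi hip).1 (h i)⟩
    · rintro ⟨h1, h2⟩ z
      by_cases hz : 0 ≤ z ∧ z ≤ (p : ℤ) - 2
      · obtain ⟨hz0, hzp⟩ := hz
        lift z to ℕ using hz0
        rcases Nat.eq_zero_or_pos z with rfl | hz1
        · exact h0.2 h1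
        · exact (hpos z hz1 (by omega)).2 (h2 z hz1 (by omega))
      · unfold pcharConstraint
        rw [if_neg hz, LinearMap.zero_apply]

theorem mem_coboundaries_iff {p : ℕ} (x lam lam' : K) (c : ℤ → K →ₗ[K] (Fin p → K))
    (hc : ∀ z : ℤ, (z < 0 ∨ (p : ℤ) - 2 < z) → c z = 0) :
    c ∈ coboundaries K p 0 (vermaRho K p x lam) (oneDimRho K lam') ↔
      ∃ f : Fin p → K, ∀ k : ℕ, k + 2 ≤ p →
        c (k : ℤ) 1 = vermaRho K p x lam (k : ℤ) f - (if k = 0 then lam' else 0) • f := by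
  have hmap (f : K →ₗ[K] (Fin p → K)) (a : K) : f a = a • f 1 := by
    rw [← map_smul, smul_eq_mul, mul_one]
  unfold coboundaries
  rw [LinearMap.mem_range]
  constructor
  · rintro ⟨f, rfl⟩
    refine ⟨f 1, fun k hk => ?_⟩
    rw [LinearMap.pi_apply, if_pos (by omega)]
    simp only [LinearMap.sub_apply, LinearMap.llcomp_apply, LinearMap.lcomp_apply,
      oneDimRho_apply_one, Nat.cast_eq_zero]
    rw [hmap f (if k = 0 then lam' else 0)]
  · rintro ⟨f, hf⟩
    refine ⟨LinearMap.toSpanSingleton K _ f, funext fun z => ?_⟩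
    rw [LinearMap.pi_apply]
    split_ifs with hz
    · obtain ⟨hz0, hzp⟩ := hz
      lift z to ℕ using hz0
      rw [LinearMap.ext_ring_iff, hf z (by omega)]
      simp only [LinearMap.sub_apply, LinearMap.llcomp_apply, LinearMap.lcomp_apply,
        oneDimRho_apply_one, Nat.cast_eq_zero, LinearMap.toSpanSingleton_apply, one_smul]
    · rw [hc z (by omega), LinearMap.zero_apply]

end

section

variable {K : Type} [Field K]

/-- The coefficient of `v_{N-r}` in the vector assigned to `e_{r+2}` by the unique normalized
cocycle: up to the factor `r!` it is the coefficient of `e_1^r · v_N`. -/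
def stdCoef (lam : K) (N r : ℕ) : K :=
  (-1) ^ r * (N.choose r : K) * ∏ s ∈ Finset.range r, (2 * lam - N + 1 + s)

/-- The vector `stdCoef lam N r • v_{N-r}`, to be read as `0` if `r > N`. -/
def stdVec (p : ℕ) (lam : K) (N r : ℕ) : Fin p → K :=
  fun k => if (k : ℕ) + r = N then stdCoef lam N r else 0

/-- The obstruction to the cocycle identity for `e_{a+2}` and `e_{b+2}`. -/
def stdDefect (lam : K) (N a b : ℕ) : K :=
  ((b : K) - a) * stdCoef lam N (a + b + 2)
    - (wCoef K lam (a + 2) (N - b) * stdCoef lam N b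
      - wCoef K lam (b + 2) (N - a) * stdCoef lam N a)

@[simp]
theorem stdCoef_zero (lam : K) (N : ℕ) : stdCoef lam N 0 = 1 := by simp [stdCoef]

theorem stdCoef_succ (lam : K) {N r : ℕ} (hr : r ≤ N) :
    ((r : K) + 1) * stdCoef lam N (r + 1) = wCoef K lam 1 (N - r) * stdCoef lam N r := by
  have h := congrArg (Nat.cast (R := K)) (Nat.choose_succ_right_eq N r)
  push_cast [Nat.cast_sub hr] at h
  rw [wCoef_one_left, Nat.cast_sub hr]
  simp only [stdCoef, Finset.prod_range_succ, pow_succ]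
  linear_combination (-((-1) ^ r * (∏ s ∈ Finset.range r, (2 * lam - N + 1 + s))
    * (2 * lam - N + 1 + r))) * h

theorem stdDefect_swap (lam : K) (N a b : ℕ) : stdDefect lam N b a = -stdDefect lam N a b := by
  unfold stdDefect
  rw [add_comm b a]
  ring

theorem extendZero_stdVec {p : ℕ} (lam : K) {N : ℕ} (hN : N < p) (r n : ℕ) :
    extendZero (stdVec p lam N r) n = if n + r = N then stdCoef lam N r else 0 := by
  unfold stdVec
  rw [extendZero_restrict (f := fun n => if n + r = N then stdCoef lam N r else 0)]
  intro n hn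
  exact if_neg (by omega)

theorem extendZero_vermaRho_stdVec {p : ℕ} [CharP K p] (hp : 1 < p) (x lam : K) {N : ℕ}
    (hN : N < p) (i r n : ℕ) :
    extendZero (vermaRho K p x lam (i : ℤ) (stdVec p lam N r)) n
      = if n + (i + r) = N then wCoef K lam i (N - r) * stdCoef lam N r else 0 := by
  rw [extendZero_vermaRho hp, extendZero_stdVec lam hN, ← add_assoc]
  split_ifs with h
  · rw [← h, Nat.add_sub_cancel]
  · exact mul_zero _

theorem vermaRho_one_stdVec {p : ℕ} [CharP K p] (hp : 1 < p) (x lam : K) {N : ℕ}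
    (hN : N < p) (r : ℕ) :
    vermaRho K p x lam 1 (stdVec p lam N r) = ((r : K) + 1) • stdVec p lam N (r + 1) := by
  refine extendZero_ext fun n => ?_
  have h := extendZero_vermaRho_stdVec hp x lam hN 1 r n
  rw [Nat.cast_one] at h
  rw [h, extendZero_smul, extendZero_stdVec lam hN, add_comm 1 r]
  split_ifs with hn
  · rw [stdCoef_succ lam (by omega)]
  · rw [mul_zero]

theorem vermaRho_commutator_stdVec {p : ℕ} [CharP K p] (hp : 1 < p) (x lam : K) {N : ℕ}
    (hN : N < p) (a b n : ℕ) :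
    extendZero (((b : K) - a) • stdVec p lam N (a + b + 2)
      - (vermaRho K p x lam ((a + 2 : ℕ) : ℤ) (stdVec p lam N b)
        - vermaRho K p x lam ((b + 2 : ℕ) : ℤ) (stdVec p lam N a))) n
      = if n + (a + b + 2) = N then stdDefect lam N a b else 0 := by
  simp only [extendZero_sub, extendZero_smul, extendZero_stdVec lam hN,
    extendZero_vermaRho_stdVec hp x lam hN, stdDefect]
  rw [show b + 2 + a = a + b + 2 by ring, show a + 2 + b = a + b + 2 by ring]
  split_ifs <;> simp

theorem natCast_inj_of_lt {p : ℕ} [CharP K p] {a b : ℕ} (ha : a < p) (hb : b < p)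
    (h : (a : K) = b) : a = b :=
  CharP.natCast_injOn_Iio K p ha hb h

theorem natCast_ne_zero_of_lt (p : ℕ) [CharP K p] {a : ℕ} (h0 : 0 < a) (ha : a < p) :
    (a : K) ≠ 0 := fun h =>
  h0.ne' (natCast_inj_of_lt (K := K) (p := p) ha (by omega) (by rw [h, Nat.cast_zero]))

/-- Every cocycle differs from a multiple of the normalized one by a coboundary, and the multiple
is annihilated by the obstructions. -/
theorem exists_cocycle_normal_form {p : ℕ} [CharP K p] (hp : 3 < p) (x lam lam' : K)
    {d N : ℕ} (hd0 : 0 < d) (hd : d < p) (hdval : (d : K) = lam - lam')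
    (hA : 2 * lam - d + 1 ≠ 0) (hN : N < p) (hNval : (N : K) = d - 2)
    {c : ℤ → K →ₗ[K] (Fin p → K)}
    (hc : c ∈ cocycles K p 0 (vermaRho K p x lam) (oneDimRho K lam')) :
    ∃ (f : Fin p → K) (t : K),
      (∀ k : ℕ, k + 2 ≤ p → c (k : ℤ) 1
        = vermaRho K p x lam (k : ℤ) f - (if k = 0 then lam' else 0) • f
          + t • (if k < 2 then 0 else stdVec p lam N (k - 2))) ∧
      (∀ a b : ℕ, a + b + 6 ≤ p → a + b + 2 ≤ N → t * stdDefect lam N a b = 0) ∧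
      (p ≤ N + 3 → t * (wCoef K lam 1 (N - (p - 4)) * stdCoef lam N (p - 4)) = 0) := by
  have hp1 : 1 < p := by omega
  obtain ⟨hsupp, hbr, hpc, -⟩ := (mem_cocycles_iff hp1 x lam lam' c).1 hc
  have hw1 : wCoef K lam 1 d ≠ 0 := by
    rw [wCoef_one_left]
    exact mul_ne_zero (neg_ne_zero.2 (natCast_ne_zero_of_lt p hd0 hd)) hA
  set g : ℕ → K := fun n => if n < p then (if n = d then extendZero (c 1 1) (d - 1) / wCoef K lam 1 d
    else extendZero (c 0 1) n / (lam - n - lam')) else 0 with hg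
  set f : Fin p → K := fun k => g k with hf
  have hfg (n : ℕ) : extendZero f n = g n :=
    extendZero_restrict (f := g) (fun n hn => if_neg (by omega)) n
  set l : ℕ → K := fun k => if k = 0 then lam' else 0 with hl
  set u : ℕ → Fin p → K := fun k => c (k : ℤ) 1 - (vermaRho K p x lam (k : ℤ) f - l k • f) with hu
  have hubr (i j : ℕ) (hi : i + 2 ≤ p) (hj : j + 2 ≤ p) :
      ((j : K) - i) • u (i + j) = vermaRho K p x lam (i : ℤ) (u j) + l j • u i
        - vermaRho K p x lam (j : ℤ) (u i) - l i • u j := by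
    have h1 := hbr i j hi hj
    have h2 := vermaRho_commutator hp1 x lam i j f
    have h3 : ((j : K) - i) * l (i + j) = 0 := by
      simp only [hl]
      split_ifs with h
      · obtain ⟨rfl, rfl⟩ : i = 0 ∧ j = 0 := by omega
        simp
      · simp
    have h4 : ((j : K) - i) • l (i + j) • f = 0 := by rw [smul_smul, h3, zero_smul]
    simp only [hu, smul_sub, map_sub, map_smul, h4, h1, ← h2]
    module
  have hu0 : u 0 = 0 := by
    refine extendZero_ext fun n => ?_
    simp only [hu, hl, if_true, extendZero_sub, extendZero_smul, Nat.cast_zero,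
      extendZero_vermaRho_zero hp1, hfg, extendZero_zero]
    by_cases hn : n < p
    · by_cases hnd : n = d
      · have h5 := hpc n
        have h6 : lam - (n : K) = lam' := by rw [hnd, hdval]; ring
        have h7 : ∑ k ∈ Finset.range p, lam' ^ k * lam' ^ (p - 1 - k) = 0 := by
          rw [Finset.sum_congr rfl (g := fun _ => lam' ^ (p - 1))]
          · simp
          · intro k hk
            rw [Finset.mem_range] at hk
            rw [← pow_add]
            congr 1
            omega
        rw [h6, h7, zero_mul] at h5
        rw [h6, ← h5]
        ring
      · have h5 : lam - (n : K) - lam' ≠ 0 := by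
          intro h5
          refine hnd (natCast_inj_of_lt (K := K) hn hd ?_)
          rw [hdval]
          linear_combination -h5
        simp only [hg, if_pos hn, if_neg hnd]
        field_simp
        ring
    · rw [extendZero_of_le _ (by omega)]
      simp [hg, hn]
  have hwt (j : ℕ) (hj : j + 2 ≤ p) (n : ℕ) (hn : (n : K) + j ≠ d) :
      extendZero (u j) n = 0 := by
    by_cases hj0 : j = 0
    · simp [hj0, hu0]
    have h := congrArg (fun v => extendZero v n) (hubr 0 j (by omega) hj)
    simp only [hu0, hl, hj0, if_false, if_true, extendZero_smul, extendZero_sub, extendZero_add,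
      extendZero_vermaRho_zero hp1, map_zero, extendZero_zero, zero_add, Nat.cast_zero] at h
    have h2 : ((n : K) + j - d) * extendZero (u j) n = 0 := by
      rw [hdval]
      linear_combination h
    exact (mul_eq_zero.1 h2).resolve_left (sub_ne_zero.2 hn)
  have hu1 : u 1 = 0 := by
    refine extendZero_ext fun n => ?_
    rw [extendZero_zero]
    by_cases hn : n < p
    swap
    · exact extendZero_of_le _ (by omega)
    by_cases hnd : n + 1 = d
    · have h := extendZero_vermaRho hp1 x lam 1 f n
      obtain rfl : n = d - 1 := by omega
      rw [hnd, hfg] at h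
      simp only [hu, hl, one_ne_zero, if_false, extendZero_sub, extendZero_smul, h]
      simp only [hg, if_pos hd, if_true, Nat.cast_one]
      field_simp
      ring
    · refine hwt 1 (by omega) n fun h => hnd ?_
      by_cases hnp : n + 1 < p
      · exact natCast_inj_of_lt (K := K) hnp hd (by exact_mod_cast h)
      · obtain rfl : p = n + 1 := by omega
        have h0 := CharP.cast_eq_zero K (n + 1)
        push_cast at h0 h
        exact absurd (h.symm.trans h0) (natCast_ne_zero_of_lt (n + 1) hd0 hd)
  have hu2 : u 2 = extendZero (u 2) N • stdVec p lam N 0 := by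
    refine extendZero_ext fun n => ?_
    rw [extendZero_smul, extendZero_stdVec lam hN, stdCoef_zero, add_zero]
    split_ifs with h
    · rw [h, mul_one]
    · rw [mul_zero]
      by_cases hn : n < p
      · refine hwt 2 (by omega) n fun h2 => h (natCast_inj_of_lt (K := K) hn hN ?_)
        rw [hNval, ← h2]
        push_cast
        ring
      · exact extendZero_of_le _ (by omega)
  set t := extendZero (u 2) N with ht
  have hur (r : ℕ) (hr : r + 4 ≤ p) : u (r + 2) = t • stdVec p lam N r := by
    induction r with
    | zero => exact hu2
    | succ r ih =>
      have h := hubr 1 (r + 2) (by omega) (by omega)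
      simp only [hl, one_ne_zero, if_false, hu1, map_zero, zero_smul, sub_zero, smul_zero,
        add_zero, ih (by omega), map_smul, Nat.cast_one, vermaRho_one_stdVec hp1 x lam hN] at h
      have h0 : ((r : K) + 1) ≠ 0 := by
        exact_mod_cast natCast_ne_zero_of_lt (K := K) p (Nat.succ_pos r) (by omega)
      have h1 : ((r : K) + 1) • u (r + 1 + 2) = ((r : K) + 1) • t • stdVec p lam N (r + 1) := by
        rw [smul_comm _ t, ← h, show 1 + (r + 2) = r + 1 + 2 by ring]
        congr 1
        push_cast
        ring
      exact smul_right_injective _ h0 h1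
  refine ⟨f, t, fun k hk => ?_, fun a b hab hN2 => ?_, fun hpN => ?_⟩
  · have h : c (k : ℤ) 1 = vermaRho K p x lam (k : ℤ) f - l k • f + u k := by
      simp only [hu]; abel
    rw [h]
    congr 1
    split_ifs with hk2
    · have : k = 0 ∨ k = 1 := by omega
      rcases this with rfl | rfl <;> simp [hu0, hu1]
    · rw [← hur (k - 2) (by omega)]
      congr 1
      omega
  · have h := hubr (a + 2) (b + 2) (by omega) (by omega)
    rw [show a + 2 + (b + 2) = a + b + 2 + 2 by ring, hur _ (by omega), hur _ (by omega),
      hur _ (by omega)] at h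
    have h2 := vermaRho_commutator_stdVec hp1 x lam hN a b (N - (a + b + 2))
    rw [if_pos (by omega)] at h2
    rw [← h2, ← extendZero_smul, ← extendZero_zero (K := K) (p := p) (N - (a + b + 2))]
    congr 1
    simp only [hl, Nat.add_eq_zero_iff, OfNat.ofNat_ne_zero, and_false, if_false, zero_smul,
      sub_zero, add_zero, map_smul] at h
    have h3 : (((b + 2 : ℕ) : K) - ((a + 2 : ℕ) : K)) = (b : K) - a := by push_cast; ring
    rw [h3] at h
    rw [smul_sub, smul_comm t, h, smul_sub, sub_self]
  · have h := hubr 1 (p - 4 + 2) (by omega) (by omega)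
    have h1 : u (1 + (p - 4 + 2)) = 0 := by
      have e1 : c ((1 + (p - 4 + 2) : ℕ) : ℤ) = 0 := hsupp _ (by right; omega)
      have e2 : vermaRho K p x lam ((1 + (p - 4 + 2) : ℕ) : ℤ) f = 0 := by
        refine extendZero_ext fun n => ?_
        simp only [vermaRho, vermaMat]
        rw [if_neg (by omega), if_neg (by omega)]
        simp
      simp only [hu, hl, e1, e2]
      simp
    rw [h1, hur _ (by omega), hu1] at h
    have h2 := extendZero_vermaRho_stdVec hp1 x lam hN 1 (p - 4) (N - (1 + (p - 4)))
    rw [if_pos (by omega)] at h2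
    rw [← h2, ← extendZero_smul, ← extendZero_zero (K := K) (p := p) (N - (1 + (p - 4)))]
    congr 1
    simpa [hl] using h.symm

theorem finrank_extSpace_eq_zero {p : ℕ} [CharP K p] (hp : 3 < p) (x lam lam' : K)
    {d N : ℕ} (hd0 : 0 < d) (hd : d < p) (hdval : (d : K) = lam - lam')
    (hA : 2 * lam - d + 1 ≠ 0) (hN : N < p) (hNval : (N : K) = d - 2)
    (h : ∀ t : K,
      (∀ a b : ℕ, a + b + 6 ≤ p → a + b + 2 ≤ N → t * stdDefect lam N a b = 0) →
      (p ≤ N + 3 → t * (wCoef K lam 1 (N - (p - 4)) * stdCoef lam N (p - 4)) = 0) → t = 0) :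
    Module.finrank K (extSpace K p 0 (vermaRho K p x lam) (oneDimRho K lam')) = 0 := by
  have : Subsingleton (extSpace K p 0 (vermaRho K p x lam) (oneDimRho K lam')) := by
    refine Submodule.Quotient.subsingleton_iff.2 (eq_top_iff.2 ?_)
    rintro ⟨c, hc⟩ -
    rw [Submodule.mem_comap]
    obtain ⟨f, t, hf, h1, h2⟩ :=
      exists_cocycle_normal_form hp x lam lam' hd0 hd hdval hA hN hNval hc
    obtain rfl := h t h1 h2
    have hs := ((mem_cocycles_iff (by omega) x lam lam' c).1 hc).1
    exact (mem_coboundaries_iff x lam lam' c hs).2 ⟨f, fun k hk => by rw [hf k hk]; simp⟩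
  exact Module.finrank_zero_of_subsingleton

/-- The normalized cochain. -/
def stdCochain (p : ℕ) (lam : K) (N : ℕ) : ℤ → K →ₗ[K] (Fin p → K) := fun z =>
  if 2 ≤ z ∧ z ≤ (p : ℤ) - 2 then LinearMap.toSpanSingleton K _ (stdVec p lam N (z - 2).toNat)
  else 0

theorem stdVec_eq_zero {p : ℕ} {lam : K} {N r : ℕ} (h : stdCoef lam N r = 0) :
    stdVec p lam N r = 0 := by
  funext k
  simp [stdVec, h]

theorem stdCochain_apply_one {p : ℕ} {lam : K} {N : ℕ}
    (hg : ∀ r, p ≤ r + 3 → stdCoef lam N r = 0) (k : ℕ) :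
    stdCochain p lam N (k : ℤ) 1 = if k < 2 then 0 else stdVec p lam N (k - 2) := by
  unfold stdCochain
  by_cases hk : k < 2
  · rw [if_neg (by omega), if_pos hk, LinearMap.zero_apply]
  · rw [if_neg hk]
    by_cases hkp : (k : ℤ) ≤ (p : ℤ) - 2
    · rw [if_pos ⟨by omega, hkp⟩, LinearMap.toSpanSingleton_apply, one_smul]
      congr 1
      omega
    · rw [if_neg (by omega), LinearMap.zero_apply, stdVec_eq_zero (hg _ (by omega))]

theorem stdCochain_mem_cocycles {p : ℕ} [CharP K p] (hp : 3 < p) (x lam lam' : K)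
    {d N : ℕ} (hdval : (d : K) = lam - lam') (hN : N < p) (hNval : (N : K) = d - 2)
    (hg : ∀ r, p ≤ r + 3 → stdCoef lam N r = 0)
    (hrel : ∀ a b : ℕ, a < b → a + b + 2 ≤ N → stdDefect lam N a b = 0) :
    stdCochain p lam N ∈ cocycles K p 0 (vermaRho K p x lam) (oneDimRho K lam') := by
  have hp1 : 1 < p := by omega
  have hrel' (a b : ℕ) (hab : a + b + 2 ≤ N) : stdDefect lam N a b = 0 := by
    rcases lt_trichotomy a b with h | rfl | h
    · exact hrel a b h hab
    · simp [stdDefect]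
    · rw [stdDefect_swap, hrel b a h (by omega), neg_zero]
  set l : ℕ → K := fun k => if k = 0 then lam' else 0 with hl
  set w : ℕ → Fin p → K := fun k => if k < 2 then 0 else stdVec p lam N (k - 2) with hw
  have hw0 : w 0 = 0 := by simp [hw]
  have hw1 : w 1 = 0 := by simp [hw]
  have hw2 (r : ℕ) : w (r + 2) = stdVec p lam N r := by simp [hw]
  have hz (j : ℕ) : ((j : K) - (0 : ℕ)) • w (0 + j) = vermaRho K p x lam ((0 : ℕ) : ℤ) (w j)
      + l j • w 0 - vermaRho K p x lam (j : ℤ) (w 0) - l 0 • w j := by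
    rcases j with _ | _ | r
    · simp [hw0]
    · simp [hw1, hw0]
    · rw [zero_add, hw0, hw2]
      refine extendZero_ext fun n => ?_
      simp only [hl, if_true, map_zero, smul_zero, sub_zero, add_zero, extendZero_sub,
        extendZero_smul, extendZero_vermaRho hp1, wCoef_zero_left, extendZero_stdVec lam hN]
      split_ifs with h
      · have h2 := congrArg (Nat.cast (R := K)) h
        rw [hNval, hdval] at h2
        push_cast at h2 ⊢
        linear_combination stdCoef lam N r * h2
      · simp
  have ho (j : ℕ) (hj : 1 ≤ j) : ((j : K) - (1 : ℕ)) • w (1 + j)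
      = vermaRho K p x lam ((1 : ℕ) : ℤ) (w j)
      + l j • w 1 - vermaRho K p x lam (j : ℤ) (w 1) - l 1 • w j := by
    rcases j with _ | _ | r
    · omega
    · simp [hw1, hl]
    · rw [hw1, show 1 + (r + 1 + 1) = (r + 1) + 2 by ring, hw2, hw2]
      simp only [hl, one_ne_zero, if_false, map_zero, smul_zero, zero_smul, sub_zero, add_zero,
        Nat.cast_one, vermaRho_one_stdVec hp1 x lam hN]
      congr 1
      push_cast
      ring
  have hpp (a b : ℕ) : (((b + 2 : ℕ) : K) - (a + 2 : ℕ)) • w (a + 2 + (b + 2))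
      = vermaRho K p x lam ((a + 2 : ℕ) : ℤ) (w (b + 2)) + l (b + 2) • w (a + 2)
        - vermaRho K p x lam ((b + 2 : ℕ) : ℤ) (w (a + 2)) - l (a + 2) • w (b + 2) := by
    rw [show a + 2 + (b + 2) = a + b + 2 + 2 by ring, hw2, hw2, hw2]
    simp only [hl, Nat.add_eq_zero_iff, OfNat.ofNat_ne_zero, and_false, if_false, zero_smul,
      sub_zero, add_zero]
    rw [show (((b + 2 : ℕ) : K) - ((a + 2 : ℕ) : K)) = (b : K) - a by push_cast; ring,
      ← sub_eq_zero]
    refine extendZero_ext fun n => ?_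
    rw [vermaRho_commutator_stdVec hp1 x lam hN, extendZero_zero]
    split_ifs with h
    · exact hrel' a b (by omega)
    · rfl
  have hswap (i j : ℕ) (h : ((j : K) - i) • w (i + j) = vermaRho K p x lam (i : ℤ) (w j)
      + l j • w i - vermaRho K p x lam (j : ℤ) (w i) - l i • w j) :
      ((i : K) - j) • w (j + i) = vermaRho K p x lam (j : ℤ) (w i)
      + l i • w j - vermaRho K p x lam (i : ℤ) (w j) - l j • w i := by
    rw [add_comm j i, ← neg_sub (j : K) i, neg_smul, h]
    abel
  refine (mem_cocycles_iff hp1 x lam lam' _).2 ⟨fun z hz => ?_, fun i j _ _ => ?_, fun n => ?_,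
    fun i hi hip => ?_⟩
  · exact if_neg (by omega)
  · rw [stdCochain_apply_one hg, stdCochain_apply_one hg, stdCochain_apply_one hg]
    change ((j : K) - i) • w (i + j) = vermaRho K p x lam (i : ℤ) (w j)
      + l j • w i - vermaRho K p x lam (j : ℤ) (w i) - l i • w j
    rcases i with _ | _ | a
    · exact hz j
    · rcases j with _ | j
      · exact hswap _ _ (hz _)
      · exact ho _ (by omega)
    · rcases j with _ | _ | b
      · exact hswap _ _ (hz _)
      · exact hswap _ _ (ho _ (by omega))
      · exact hpp a b
  · have h0 := stdCochain_apply_one hg 0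
    rw [Nat.cast_zero, if_pos (by omega)] at h0
    simp [h0]
  · rcases Nat.lt_or_ge i 2 with h | h
    · rw [stdCochain_apply_one hg, if_pos h, map_zero]
    · rw [vermaRho_pow_eq_zero hp1 x lam h, LinearMap.zero_apply]

theorem finrank_extSpace_eq_one {p : ℕ} [CharP K p] (hp : 3 < p) (x lam lam' : K)
    {d N : ℕ} (hd0 : 0 < d) (hd : d < p) (hdval : (d : K) = lam - lam')
    (hA : 2 * lam - d + 1 ≠ 0) (hN : N < p) (hNval : (N : K) = d - 2)
    (hg : ∀ r, p ≤ r + 3 → stdCoef lam N r = 0)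
    (hrel : ∀ a b : ℕ, a < b → a + b + 2 ≤ N → stdDefect lam N a b = 0) :
    Module.finrank K (extSpace K p 0 (vermaRho K p x lam) (oneDimRho K lam')) = 1 := by
  have hp1 : 1 < p := by omega
  have hcoc := stdCochain_mem_cocycles hp x lam lam' hdval hN hNval hg hrel
  refine finrank_eq_one (Submodule.Quotient.mk ⟨stdCochain p lam N, hcoc⟩) ?_ ?_
  · intro h
    rw [Submodule.Quotient.mk_eq_zero, Submodule.mem_comap] at h
    obtain ⟨f, hf⟩ := (mem_coboundaries_iff x lam lam' _
      ((mem_cocycles_iff hp1 x lam lam' _).1 hcoc).1).1 h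
    simp only [stdCochain_apply_one hg] at hf
    have hsupp (n : ℕ) (hn : n ≠ d) : extendZero f n = 0 := by
      by_cases hnp : n < p
      swap
      · exact extendZero_of_le _ (by omega)
      have h0 := congrArg (fun v => extendZero v n) (hf 0 (by omega))
      simp only [Nat.ofNat_pos, if_true, extendZero_zero, extendZero_sub, extendZero_smul,
        extendZero_vermaRho hp1, wCoef_zero_left, add_zero] at h0
      have h1 : ((n : K) - d) * extendZero f n = 0 := by
        rw [hdval]
        linear_combination h0
      exact (mul_eq_zero.1 h1).resolve_left
        (sub_ne_zero.2 fun h2 => hn (natCast_inj_of_lt (K := K) hnp hd h2))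
    have hfd : extendZero f d = 0 := by
      have h1 := congrArg (fun v => extendZero v (d - 1)) (hf 1 (by omega))
      simp only [Nat.one_lt_ofNat, if_true, extendZero_zero, extendZero_sub, extendZero_smul,
        extendZero_vermaRho hp1, wCoef_one_left, one_ne_zero, if_false, zero_mul, sub_zero,
        Nat.sub_add_cancel hd0] at h1
      exact (mul_eq_zero.1 h1.symm).resolve_left
        (mul_ne_zero (neg_ne_zero.2 (natCast_ne_zero_of_lt p hd0 hd)) hA)
    have hf0 : f = 0 := extendZero_ext fun n => by
      by_cases hn : n = d
      · rw [hn, hfd, extendZero_zero]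
      · rw [hsupp n hn, extendZero_zero]
    have h2 := congrArg (fun v => extendZero v N) (hf 2 (by omega))
    simp [hf0, extendZero_stdVec lam hN] at h2
  · intro w
    obtain ⟨⟨c, hc⟩, rfl⟩ := Submodule.Quotient.mk_surjective _ w
    obtain ⟨f, t, hf, -, -⟩ :=
      exists_cocycle_normal_form hp x lam lam' hd0 hd hdval hA hN hNval hc
    refine ⟨t, ?_⟩
    rw [← Submodule.Quotient.mk_smul, Submodule.Quotient.eq, Submodule.mem_comap]
    have hmem := Submodule.sub_mem _ (Submodule.smul_mem _ t hcoc) hc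
    refine (mem_coboundaries_iff x lam lam' _
      ((mem_cocycles_iff hp1 x lam lam' _).1 hmem).1).2 ⟨-f, fun k hk => ?_⟩
    change t • stdCochain p lam N (k : ℤ) 1 - c (k : ℤ) 1 = _
    rw [hf k hk, stdCochain_apply_one hg, map_neg]
    module

end

section

variable {K : Type} [Field K]

theorem cast_descFactorial_succ (n k : ℕ) :
    (n.descFactorial (k + 1) : K) = ((n : K) - k) * (n.descFactorial k : K) := by
  rw [Nat.descFactorial_succ, Nat.cast_mul]
  rcases le_or_gt k n with h | h
  · rw [Nat.cast_sub h]
  · simp [Nat.descFactorial_of_lt h]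

theorem stdCoef_eq_zero_of_lt (lam : K) {N r : ℕ} (h : N < r) : stdCoef lam N r = 0 := by
  simp [stdCoef, Nat.choose_eq_zero_of_lt h]

theorem stdCoef_succ' (lam : K) {N r : ℕ} (hr : r ≤ N) :
    ((r : K) + 1) * stdCoef lam N (r + 1)
      = -((N : K) - r) * (2 * lam - N + 1 + r) * stdCoef lam N r := by
  rw [stdCoef_succ lam hr, wCoef_one_left, Nat.cast_sub hr]
  ring

theorem factorial_mul_stdCoef (lam : K) {N r : ℕ} (hr : r ≤ N) :
    (r.factorial : K) * stdCoef lam N r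
      = ∏ s ∈ Finset.range r, (-((N : K) - s) * (2 * lam - N + 1 + s)) := by
  induction r with
  | zero => simp
  | succ r ih =>
    rw [Finset.prod_range_succ, ← ih (by omega), Nat.factorial_succ]
    push_cast
    linear_combination (r.factorial : K) * stdCoef_succ' lam (show r ≤ N by omega)

theorem six_mul_stdDefect_zero_one (lam : K) {N : ℕ} (hN : 3 ≤ N) :
    6 * stdDefect lam N 0 1 = -((N : K) * (N - 1) * (N - 2)) * ((2 * lam - N + 1 - 2) *
      ((2 * lam - N + 1) ^ 2 - (2 * lam - N + 1) - 6 - 6 * lam)) := by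
  have h1 := factorial_mul_stdCoef lam (show 1 ≤ N by omega)
  have h3 := factorial_mul_stdCoef lam hN
  simp only [Nat.factorial, Finset.prod_range_succ, Finset.prod_range_zero] at h1 h3
  push_cast at h1 h3
  simp only [stdDefect, wCoef, cast_descFactorial_succ, Nat.descFactorial_zero, stdCoef_zero,
    zero_add, Nat.reduceAdd, Nat.cast_sub (show 1 ≤ N by omega), Nat.cast_zero, Nat.cast_one,
    Nat.cast_ofNat, Nat.sub_zero]
  linear_combination h3 - 6 * ((N : K) - 1) * (N - 2) * (3 * lam - N + 3) * h1

theorem twelve_mul_stdDefect_zero_two (lam : K) {N : ℕ} (hN : 4 ≤ N)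
    (hE : (2 * lam - N + 1) ^ 2 - (2 * lam - N + 1) - 6 - 6 * lam = 0) :
    12 * stdDefect lam N 0 2 = 0 := by
  have h2 := factorial_mul_stdCoef lam (show 2 ≤ N by omega)
  have h4 := factorial_mul_stdCoef lam hN
  simp only [Nat.factorial, Finset.prod_range_succ, Finset.prod_range_zero] at h2 h4
  push_cast at h2 h4
  simp only [stdDefect, wCoef, cast_descFactorial_succ, Nat.descFactorial_zero, stdCoef_zero,
    zero_add, Nat.reduceAdd, Nat.cast_sub (show 2 ≤ N by omega), Nat.cast_zero, Nat.cast_one,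
    Nat.cast_ofNat, Nat.sub_zero]
  linear_combination h4 - 6 * ((N : K) - 2) * (N - 3) * (3 * lam - N + 4) * h2
    + (N : K) * (N - 1) * (N - 2) * (N - 3)
      * ((2 * lam - N + 1) ^ 2 + (2 * lam - N + 1) - 6) * hE

theorem mul_stdDefect_zero_three (lam : K) {N : ℕ} (hN : 5 ≤ N)
    (hE : (2 * lam - N + 1) ^ 2 - (2 * lam - N + 1) - 6 - 6 * lam = 0) :
    360 * stdDefect lam N 0 3 = (N : K) * (N - 1) * (N - 2) * (N - 3) * (N - 4) *
      ((2 * lam - N + 1) * (2 * lam - N) * (2 * lam - N - 1) * (2 * lam - N - 2)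
        * (2 * lam - N - 3)) := by
  have h3 := factorial_mul_stdCoef lam (show 3 ≤ N by omega)
  have h5 := factorial_mul_stdCoef lam hN
  simp only [Nat.factorial, Finset.prod_range_succ, Finset.prod_range_zero] at h3 h5
  push_cast at h3 h5
  simp only [stdDefect, wCoef, cast_descFactorial_succ, Nat.descFactorial_zero, stdCoef_zero,
    zero_add, Nat.reduceAdd, Nat.cast_sub (show 3 ≤ N by omega), Nat.cast_zero, Nat.cast_one,
    Nat.cast_ofNat, Nat.sub_zero]
  linear_combination 9 * h5 - 60 * ((N : K) - 3) * (N - 4) * (3 * lam - N + 5) * h3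
    - (N : K) * (N - 1) * (N - 2) * (N - 3) * (N - 4)
      * (10 * (2 * lam - N + 1) * (2 * lam - N + 2) * (2 * lam - N + 3) - 240) * hE

theorem natCast_sub_ne_zero {p N k : ℕ} [CharP K p] (hk : k < N) (hN : N < p) :
    (N : K) - k ≠ 0 := fun h =>
  hk.ne' (natCast_inj_of_lt (K := K) hN (hk.trans hN) (sub_eq_zero.1 h))

/-- For `N ≥ 3` the first obstruction is a quadratic equation for `lam`. -/
theorem stdDefect_zero_one_eq_zero_iff {p : ℕ} [CharP K p] (hp : 3 < p) {lam : K} {N : ℕ}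
    (h3 : 3 ≤ N) (hN : N < p) (hA : 2 * lam - N + 1 ≠ 2) :
    stdDefect lam N 0 1 = 0 ↔
      (2 * lam - N + 1) ^ 2 - (2 * lam - N + 1) - 6 - 6 * lam = 0 := by
  have h := six_mul_stdDefect_zero_one lam h3
  have e0 := natCast_sub_ne_zero (K := K) (k := 0) (by omega) hN
  have e1 := natCast_sub_ne_zero (K := K) (k := 1) (by omega) hN
  have e2 := natCast_sub_ne_zero (K := K) (k := 2) (by omega) hN
  push_cast at e0 e1 e2
  rw [sub_zero] at e0
  have k2 := natCast_ne_zero_of_lt (K := K) (a := 2) p (by omega) (by omega)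
  have k3 := natCast_ne_zero_of_lt (K := K) (a := 3) p (by omega) (by omega)
  have k6 : (6 : K) ≠ 0 := by
    rw [show (6 : K) = (2 : ℕ) * (3 : ℕ) by norm_num]
    exact mul_ne_zero k2 k3
  constructor
  · intro hz
    rw [hz, mul_zero] at h
    exact (mul_eq_zero.1 ((mul_eq_zero.1 h.symm).resolve_left
      (neg_ne_zero.2 (mul_ne_zero (mul_ne_zero e0 e1) e2)))).resolve_left (sub_ne_zero.2 hA)
  · intro hz
    rw [hz, mul_zero, mul_zero] at h
    exact (mul_eq_zero.1 h).resolve_left k6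

/-- For `5 ≤ N ≤ p - 3` the obstructions in degrees 5 and 7 do not vanish simultaneously. -/
theorem stdDefect_zero_three_ne_zero {p : ℕ} [CharP K p] (hp : 3 < p) {lam : K} {N : ℕ}
    (h5 : 5 ≤ N) (hN : N + 2 < p) (hA : 2 * lam - N + 1 ≠ 2)
    (h01 : stdDefect lam N 0 1 = 0) : stdDefect lam N 0 3 ≠ 0 := by
  intro hz
  have hE := (stdDefect_zero_one_eq_zero_iff hp (by omega) (by omega) hA).1 h01
  have h := mul_stdDefect_zero_three lam h5 hE
  rw [hz, mul_zero] at h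
  have e0 := natCast_sub_ne_zero (K := K) (p := p) (N := N) (k := 0) (by omega) (by omega)
  have e1 := natCast_sub_ne_zero (K := K) (p := p) (N := N) (k := 1) (by omega) (by omega)
  have e2 := natCast_sub_ne_zero (K := K) (p := p) (N := N) (k := 2) (by omega) (by omega)
  have e3 := natCast_sub_ne_zero (K := K) (p := p) (N := N) (k := 3) (by omega) (by omega)
  have e4 := natCast_sub_ne_zero (K := K) (p := p) (N := N) (k := 4) (by omega) (by omega)
  have k3 := natCast_ne_zero_of_lt (K := K) (a := 3) p (by omega) (by omega)
  have n1 := natCast_ne_zero_of_lt (K := K) (a := N + 1) p (by omega) (by omega)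
  have n2 := natCast_ne_zero_of_lt (K := K) (a := N + 2) p (by omega) (by omega)
  push_cast at e0 e1 e2 e3 e4 k3 n1 n2
  rw [sub_zero] at e0
  have h' := (mul_eq_zero.1 h.symm).resolve_left
    (mul_ne_zero (mul_ne_zero (mul_ne_zero (mul_ne_zero e0 e1) e2) e3) e4)
  have hr : (2 * lam - N + 1) ^ 2 - 4 * (2 * lam - N + 1) - 3 = 3 * (N : K) := by
    linear_combination hE
  rcases mul_eq_zero.1 h' with h' | h'
  · rcases mul_eq_zero.1 h' with h' | h'
    · rcases mul_eq_zero.1 h' with h' | h'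
      · rcases mul_eq_zero.1 h' with h' | h'
        · refine mul_ne_zero k3 n1 ?_
          linear_combination (2 * lam - N + 1 - 4) * h' - hr
        · refine mul_ne_zero k3 n2 ?_
          linear_combination (2 * lam - N - 2) * h' - hr
      · exact hA (by linear_combination h')
    · refine mul_ne_zero k3 n2 ?_
      linear_combination (2 * lam - N) * h' - hr
  · refine mul_ne_zero k3 n1 ?_
    linear_combination (2 * lam - N + 1) * h' - hr

section TopDegree

variable {p : ℕ} [CharP K p]

theorem neg_one_pow_mul_descFactorial_mul_factorial {b : ℕ} (hb : b < p) (n : ℕ) :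
    (-1 : K) ^ n * ((p - 1 - b).descFactorial n : K) * (b.factorial : K)
      = ((b + n).factorial : K) := by
  have hc : ((p - 1 - b : ℕ) : K) = -1 - b := by
    rw [Nat.cast_sub (by omega), Nat.cast_sub (by omega), CharP.cast_eq_zero]
    simp
  induction n with
  | zero => simp
  | succ n ih =>
    rw [cast_descFactorial_succ, hc, ← add_assoc, Nat.factorial_succ, pow_succ]
    push_cast
    linear_combination ((b : K) + n + 1) * ih

theorem factorial_ne_zero_of_lt (hp : p.Prime) {n : ℕ} (hn : n < p) : (n.factorial : K) ≠ 0 := by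
  rw [Ne, CharP.cast_eq_zero_iff K p, hp.dvd_factorial]
  omega

theorem six_mul_stdCoef_one (hp : 3 < p) {r : ℕ} (hr : r + 1 ≤ p) :
    6 * stdCoef (1 : K) (p - 1) r = ((r + 3).factorial : K) := by
  induction r with
  | zero => simp [Nat.factorial]
  | succ r ih =>
    have h := stdCoef_succ' (1 : K) (show r ≤ p - 1 by omega)
    have hc : ((p - 1 : ℕ) : K) = -1 := by
      rw [Nat.cast_sub (by omega), CharP.cast_eq_zero]; simp
    rw [hc] at h
    have h0 := natCast_ne_zero_of_lt (K := K) (a := r + 1) p (by omega) (by omega)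
    rw [show r + 1 + 3 = (r + 3) + 1 by ring, Nat.factorial_succ]
    push_cast at h0 ⊢
    rw [← ih (by omega)]
    apply mul_left_cancel₀ h0
    linear_combination 6 * h

theorem stdCoef_one_eq_zero (hp : 3 < p) (hp' : p.Prime) {r : ℕ} (hr : p ≤ r + 3) :
    stdCoef (1 : K) (p - 1) r = 0 := by
  by_cases h : r + 1 ≤ p
  · have h1 := six_mul_stdCoef_one (K := K) hp h
    rw [(CharP.cast_eq_zero_iff K p _).2 (hp'.dvd_factorial.2 hr)] at h1
    have h6 := factorial_ne_zero_of_lt (K := K) hp' hp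
    refine (mul_eq_zero.1 h1).resolve_left ?_
    simpa [Nat.factorial] using h6
  · exact stdCoef_eq_zero_of_lt _ (by omega)

theorem stdDefect_one_eq_zero (hp : 3 < p) (hp' : p.Prime) {a b : ℕ} (h : a + b + 2 ≤ p - 1) :
    stdDefect (1 : K) (p - 1) a b = 0 := by
  have h6 := factorial_ne_zero_of_lt (K := K) hp' hp
  have ha := factorial_ne_zero_of_lt (K := K) hp' (show a < p by omega)
  have hb := factorial_ne_zero_of_lt (K := K) hp' (show b < p by omega)
  have gn := six_mul_stdCoef_one (K := K) hp (show a + b + 2 + 1 ≤ p by omega)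
  have ga := six_mul_stdCoef_one (K := K) hp (show a + 1 ≤ p by omega)
  have gb := six_mul_stdCoef_one (K := K) hp (show b + 1 ≤ p by omega)
  have da := neg_one_pow_mul_descFactorial_mul_factorial (K := K) (show a < p by omega) (b + 2)
  have db := neg_one_pow_mul_descFactorial_mul_factorial (K := K) (show b < p by omega) (a + 2)
  rw [show a + (b + 2) = a + b + 2 by ring] at da
  rw [show b + (a + 2) = a + b + 2 by ring] at db
  have fa : ((a + 3).factorial : K) = (a + 3) * (a + 2) * (a + 1) * a.factorial := by
    simp only [Nat.factorial_succ]; push_cast; ring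
  have fb : ((b + 3).factorial : K) = (b + 3) * (b + 2) * (b + 1) * b.factorial := by
    simp only [Nat.factorial_succ]; push_cast; ring
  have fn : ((a + b + 2 + 3).factorial : K)
      = (a + b + 5) * (a + b + 4) * (a + b + 3) * (a + b + 2).factorial := by
    simp only [Nat.factorial_succ (a + b + 2 + 2), Nat.factorial_succ (a + b + 2 + 1),
      Nat.factorial_succ (a + b + 2)]
    push_cast; ring
  rw [fa] at ga
  rw [fb] at gb
  rw [fn] at gn
  have ca : ((p - 1 - a : ℕ) : K) = -1 - a := by
    rw [Nat.cast_sub (by omega), Nat.cast_sub (by omega), CharP.cast_eq_zero]; simp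
  have cb : ((p - 1 - b : ℕ) : K) = -1 - b := by
    rw [Nat.cast_sub (by omega), Nat.cast_sub (by omega), CharP.cast_eq_zero]; simp
  have key : (6 * (a.factorial : K) * b.factorial) * stdDefect (1 : K) (p - 1) a b = 0 := by
    simp only [stdDefect, wCoef, ca, cb]
    push_cast
    linear_combination (a.factorial : K) * b.factorial * ((b : K) - a) * gn
      - (2 * a + b + 6) * 6 * (a.factorial : K) * stdCoef (1 : K) (p - 1) b * db
      - (2 * a + b + 6) * (a.factorial : K) * (a + b + 2).factorial * gb
      + (2 * b + a + 6) * 6 * (b.factorial : K) * stdCoef (1 : K) (p - 1) a * da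
      + (2 * b + a + 6) * (b.factorial : K) * (a + b + 2).factorial * ga
  refine (mul_eq_zero.1 key).resolve_left (mul_ne_zero (mul_ne_zero ?_ ha) hb)
  simpa [Nat.factorial] using h6

theorem stdCoef_neg_one (hp : 3 < p) {r : ℕ} (hr : 0 < r) :
    stdCoef (-1 : K) (p - 1) r = 0 := by
  have hc : ((p - 1 : ℕ) : K) = -1 := by
    rw [Nat.cast_sub (by omega), CharP.cast_eq_zero]; simp
  rw [stdCoef, Finset.prod_eq_zero (Finset.mem_range.2 hr), mul_zero]
  rw [hc, Nat.cast_zero]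
  ring

theorem stdDefect_neg_one_eq_zero (hp : 3 < p) {a b : ℕ} (hab : a < b) :
    stdDefect (-1 : K) (p - 1) a b = 0 := by
  have hc : ((p - 1 : ℕ) : K) = -1 := by
    rw [Nat.cast_sub (by omega), CharP.cast_eq_zero]; simp
  rw [stdDefect, stdCoef_neg_one hp (by omega), stdCoef_neg_one hp (by omega)]
  rcases Nat.eq_zero_or_pos a with rfl | ha
  · rw [Nat.sub_zero, wCoef, wCoef, hc]
    push_cast
    ring
  · rw [stdCoef_neg_one hp ha]
    ring

end TopDegree

end

open scoped Classical in
/-- If `χ` has height `-1`, `0` or `1`, `λ, λ' ∈ Λ(χ)`, `(λ, λ') ∉ Θ(χ)` and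
`λ + λ' ≠ p-1`, then, over `W_0`, `Ext(K_{λ'}, V_χ(λ)) ≅ K` in the six listed cases
and `Ext(K_{λ'}, V_χ(λ)) = 0` otherwise.  Here `d = [λ-λ']` and `(λ, λ') ∉ Θ(χ)`
means `λ ≠ λ'`, `(λ, λ') ≠ (0, p-1)` and `(λ, λ') ≠ (p-1, 0)`. -/
theorem ext_Klambda'_verma_generic
    (K : Type) [Field K] [IsAlgClosed K] (p : ℕ) [CharP K p] (hp : 3 < p)
    (chi : ℤ → K) (hsupp : ∀ k : ℤ, (k < -1 ∨ (p : ℤ) - 2 < k) → chi k = 0)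
    (hheight : ∀ k : ℤ, 1 ≤ k → chi k = 0)
    (lam lam' : K)
    (hlam : lam ^ p - lam = chi 0 ^ p) (hlam' : lam' ^ p - lam' = chi 0 ^ p)
    (hne : lam ≠ lam')
    (hTheta1 : ¬(lam = 0 ∧ lam' = (p : K) - 1)) (hTheta2 : ¬(lam = (p : K) - 1 ∧ lam' = 0))
    (hsum : lam + lam' ≠ (p : K) - 1)
    (d : ℕ) (hd : d < p) (hdval : (d : K) = lam - lam') :
    Module.finrank K (extSpace K p 0
        (vermaRho K p (chi (-1) ^ p) lam) (oneDimRho K lam'))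
      = if (d = 1 ∧ (lam = 1 ∨ lam = (p : K) - 1)) ∨ (d = 2 ∨ d = 3) ∨
            (d = 4 ∧ 5 < p) ∨ (d = 4 ∧ (lam = 0 ∨ lam = 3)) ∨
            (d = 5 ∧ (lam = 0 ∨ lam = 4)) ∨
            (d = 6 ∧ 7 < p ∧ ∃ s : K, s ^ 2 = 19 ∧ (2 * lam = 5 + s ∨ 2 * lam = 5 - s))
        then 1 else 0 := by
  have hpp : p.Prime := (CharP.char_is_prime_or_zero K p).resolve_right (by omega)
  have hp0 : (p : K) = 0 := CharP.cast_eq_zero K p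
  have hp1 : (p : K) - 1 = -1 := by rw [hp0, zero_sub]
  rw [hp1] at hsum
  rw [hp1]
  have hd0 : 0 < d := by
    rcases Nat.eq_zero_or_pos d with rfl | h
    · exact absurd (sub_eq_zero.1 (by rw [← hdval, Nat.cast_zero])) hne
    · exact h
  have hA : 2 * lam - d + 1 ≠ 0 := fun h => hsum (by rw [hdval] at h; linear_combination h)
  have k2 : (2 : K) ≠ 0 := by
    exact_mod_cast natCast_ne_zero_of_lt (K := K) (a := 2) p (by omega) (by omega)
  have k3 : (3 : K) ≠ 0 := by
    exact_mod_cast natCast_ne_zero_of_lt (K := K) (a := 3) p (by omega) (by omega)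
  rcases Nat.lt_or_ge 1 d with hd2 | hd1
  swap
  · obtain rfl : d = 1 := by omega
    rw [Nat.cast_one] at hA
    have hNlt : p - 1 < p := by omega
    have hNc : ((p - 1 : ℕ) : K) = -1 := by rw [Nat.cast_sub (by omega), hp0]; simp
    have hNval : ((p - 1 : ℕ) : K) = ((1 : ℕ) : K) - 2 := by rw [hNc]; norm_num
    have hA' : 2 * lam - ((1 : ℕ) : K) + 1 ≠ 0 := by rwa [Nat.cast_one]
    by_cases h : lam = 1 ∨ lam = -1
    · rw [if_pos (Or.inl ⟨rfl, h⟩)]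
      rcases h with rfl | rfl
      · exact finrank_extSpace_eq_one hp _ 1 lam' hd0 hd hdval hA' hNlt hNval
          (fun r hr => stdCoef_one_eq_zero hp hpp hr)
          (fun a b _ hab => stdDefect_one_eq_zero hp hpp hab)
      · exact finrank_extSpace_eq_one hp _ (-1) lam' hd0 hd hdval hA' hNlt hNval
          (fun r hr => stdCoef_neg_one hp (by omega))
          (fun a b hab _ => stdDefect_neg_one_eq_zero hp hab)
    · have h1 : lam - 1 ≠ 0 := fun h' => h (Or.inl (sub_eq_zero.1 h'))
      have h2 : lam + 1 ≠ 0 := fun h' => h (Or.inr (eq_neg_of_add_eq_zero_left h'))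
      rw [if_neg (by simp [h])]
      refine finrank_extSpace_eq_zero hp _ lam lam' hd0 hd hdval hA' hNlt hNval fun t ht ht' => ?_
      by_cases hp5 : p = 5
      · subst hp5
        have h3 := factorial_mul_stdCoef lam (show 1 ≤ 4 by omega)
        have h4 := ht' (by omega)
        simp only [Nat.factorial, Finset.prod_range_succ, Finset.prod_range_zero] at h3
        have h5 : (5 : K) = 0 := by exact_mod_cast hp0
        push_cast at h3
        simp only [Nat.reduceSub, wCoef_one_left] at h4
        push_cast at h4
        have h6 : t * (3 * (2 * 2) * (2 * 2) * ((lam - 1) * (lam + 1))) = 0 := by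
          linear_combination h4 + t * 3 * (2 * lam - 2) * h3 + t * 3 * (2 * lam - 2) * 4 * h5
        exact (mul_eq_zero.1 h6).resolve_right (by simp [k2, k3, h1, h2])
      · have hp7 : 7 ≤ p := by
          by_contra hlt
          have : p = 4 ∨ p = 6 := by omega
          rcases this with rfl | rfl <;> revert hpp <;> decide
        refine (mul_eq_zero.1 (ht 0 1 (by omega) (by omega))).resolve_right fun h01 => ?_
        have hE := (stdDefect_zero_one_eq_zero_iff hp (by omega) hNlt
          (by rw [hNc]; intro h'; exact hA (by linear_combination h'))).1 h01
        rw [hNc] at hE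
        have : 2 * 2 * ((lam - 1) * (lam + 1)) = 0 := by linear_combination hE
        simp [k2, h1, h2] at this
  obtain ⟨N, rfl⟩ : ∃ N, d = N + 2 := ⟨d - 2, by omega⟩
  have hNlt : N < p := by omega
  have hNval : (N : K) = ((N + 2 : ℕ) : K) - 2 := by push_cast; ring
  have hA2 : 2 * lam - N + 1 ≠ 2 := fun h => hA (by push_cast; linear_combination h)
  have hzero := finrank_extSpace_eq_zero hp (chi (-1) ^ p) lam lam' hd0 hd hdval hA hNlt hNval
  have hone := finrank_extSpace_eq_one hp (chi (-1) ^ p) lam lam' hd0 hd hdval hA hNlt hNval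
  have hiff := fun h3 => stdDefect_zero_one_eq_zero_iff hp (lam := lam) (N := N) h3 hNlt hA2
  have hp6 : p ≠ 6 := by rintro rfl; revert hpp; decide
  have hp4 : p ≠ 4 := by rintro rfl; revert hpp; decide
  by_cases hN1 : N ≤ 1
  · rw [if_pos (by omega)]
    exact hone (fun r hr => stdCoef_eq_zero_of_lt _ (by omega)) (fun a b _ _ => by omega)
  by_cases hN2 : N = 2
  · subst hN2
    have g1 := factorial_mul_stdCoef lam (show 1 ≤ 2 by omega)
    have g2 := factorial_mul_stdCoef lam (show 2 ≤ 2 by omega)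
    simp only [Nat.factorial, Finset.prod_range_succ, Finset.prod_range_zero] at g1 g2
    push_cast at g1 g2
    by_cases hp5 : p = 5
    · subst hp5
      have h5 : (5 : K) = 0 := by exact_mod_cast hp0
      by_cases h : lam = 0 ∨ lam = 3
      · rw [if_pos (by simp [h])]
        refine hone (fun r hr => ?_) (fun a b _ _ => by omega)
        by_cases hr2 : r = 2
        · subst hr2
          have h0 : (2 : K) * stdCoef lam 2 2 = 0 := by
            rcases h with rfl | rfl
            · linear_combination g2
            · linear_combination g2 + 12 * h5
          exact (mul_eq_zero.1 h0).resolve_left k2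
        · exact stdCoef_eq_zero_of_lt _ (by omega)
      · rw [if_neg (by simp [h])]
        refine hzero fun t _ ht' => ?_
        have h4 := ht' (by omega)
        simp only [Nat.reduceSub, wCoef_one_left] at h4
        push_cast at h4
        have h1 : lam - 3 ≠ 0 := fun h' => h (Or.inr (sub_eq_zero.1 h'))
        have h2 : lam ≠ 0 := fun h' => h (Or.inl h')
        have h6 : t * (2 * 2 * 2 * (lam * (lam - 3))) = 0 := by
          linear_combination h4 + t * 2 * lam * g1 - t * 4 * lam * h5
        exact (mul_eq_zero.1 h6).resolve_right (by simp [k2, h1, h2])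
    · rw [if_pos (by omega)]
      exact hone (fun r hr => stdCoef_eq_zero_of_lt _ (by omega)) (fun a b _ _ => by omega)
  by_cases hN3 : N = 3
  · subst hN3
    have hE : stdDefect lam 3 0 1 = 0 ↔ lam = 0 ∨ lam = 4 := by
      rw [hiff le_rfl, ← sub_eq_zero (b := (4 : K)), ← mul_eq_zero]
      push_cast
      rw [show (2 * lam - 3 + 1) ^ 2 - (2 * lam - 3 + 1) - 6 - 6 * lam
        = 2 * 2 * (lam * (lam - 4)) by ring]
      simp [k2]
    by_cases h : lam = 0 ∨ lam = 4
    · rw [if_pos (by simp [h])]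
      refine hone (fun r hr => stdCoef_eq_zero_of_lt _ (by omega)) (fun a b hab hab' => ?_)
      obtain ⟨rfl, rfl⟩ : a = 0 ∧ b = 1 := by omega
      exact hE.2 h
    · rw [if_neg (by simp [h])]
      refine hzero fun t ht _ => ?_
      exact (mul_eq_zero.1 (ht 0 1 (by omega) (by omega))).resolve_right fun h' => h (hE.1 h')
  have hp8 : p ≠ 8 := by rintro rfl; revert hpp; decide
  have hp9 : p ≠ 9 := by rintro rfl; revert hpp; decide
  have hp10 : p ≠ 10 := by rintro rfl; revert hpp; decide
  by_cases hN4 : N = 4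
  · subst hN4
    have hE : stdDefect lam 4 0 1 = 0 ↔ (2 * lam - 5) ^ 2 = 19 := by
      rw [hiff (by omega), ← sub_eq_zero (b := (19 : K))]
      push_cast
      apply Eq.congr_left
      ring
    have hs : (∃ s : K, s ^ 2 = 19 ∧ (2 * lam = 5 + s ∨ 2 * lam = 5 - s))
        ↔ (2 * lam - 5) ^ 2 = 19 := by
      constructor
      · rintro ⟨s, h1, h2 | h2⟩ <;> rw [h2, ← h1] <;> ring
      · exact fun h => ⟨2 * lam - 5, h, Or.inl (by ring)⟩
    rw [hs]
    by_cases hp7 : p = 7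
    · subst hp7
      rw [if_neg (by simp)]
      refine hzero fun t ht ht' => ?_
      by_contra ht0
      have h19 := hE.1 ((mul_eq_zero.1 (ht 0 1 (by omega) (by omega))).resolve_left ht0)
      have h4 := (mul_eq_zero.1 (ht' (by omega))).resolve_left ht0
      have h7 : (7 : K) = 0 := by exact_mod_cast hp0
      have g3 := factorial_mul_stdCoef lam (show 3 ≤ 4 by omega)
      simp only [Nat.factorial, Finset.prod_range_succ, Finset.prod_range_zero] at g3
      push_cast at g3
      simp only [Nat.reduceSub, wCoef_one_left] at h4
      push_cast at h4
      have h24 : (2 * 2 * 2 * 3) *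
          (2 * lam * ((2 * lam - 1) * ((2 * lam - 2) * (2 * lam - 3)))) = 0 := by
        linear_combination 6 * h4 + 2 * lam * g3
      simp only [mul_eq_zero, k2, k3, false_or, or_self] at h24
      rcases h24 with h | h | h | h
      · exact mul_ne_zero k2 k3 (by rw [h] at h19; linear_combination h19)
      · exact k3 (by linear_combination (2 * lam - 9) * h - h19)
      · exact k3 (by linear_combination (2 * lam - 8) * h - h19 - h7)
      · exact one_ne_zero (α := K) (by linear_combination (2 * lam - 7) * h - h19 - 2 * h7)
    · have hp7' : 7 < p := by omega
      by_cases h : (2 * lam - 5) ^ 2 = 19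
      · rw [if_pos (by simp [h, hp7'])]
        refine hone (fun r hr => stdCoef_eq_zero_of_lt _ (by omega)) (fun a b hab hab' => ?_)
        obtain ⟨rfl, rfl | rfl⟩ : a = 0 ∧ (b = 1 ∨ b = 2) := by omega
        · exact hE.2 h
        · refine (mul_eq_zero.1 (twelve_mul_stdDefect_zero_two lam le_rfl
            ((hiff (by omega)).1 (hE.2 h)))).resolve_left ?_
          rw [show (12 : K) = 2 * 2 * 3 by norm_num]
          exact mul_ne_zero (mul_ne_zero k2 k2) k3
      · rw [if_neg (by simp [h])]
        refine hzero fun t ht _ => ?_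
        exact (mul_eq_zero.1 (ht 0 1 (by omega) (by omega))).resolve_right fun h' => h (hE.1 h')
  rw [if_neg (by omega)]
  refine hzero fun t ht _ => ?_
  by_contra ht0
  have h01 := (mul_eq_zero.1 (ht 0 1 (by omega) (by omega))).resolve_left ht0
  have h03 := (mul_eq_zero.1 (ht 0 3 (by omega) (by omega))).resolve_left ht0
  exact stdDefect_zero_three_ne_zero hp (by omega) hd hA2 h01 h03
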